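/- arXiv:1702.06983 — 2 statements merged into one kernel-verified Lean document; each statement's English description precedes it below -/
import Mathlib

section
/- There exists δ ∈ (0, 1/4), depending only on p (in particular independent of the finite set 𝒵 and of the solution), with the following property: if t₁ ∈ (0, τ*) is such that for every t ∈ (0, t₁) one has 2δ·ψ̂(0) ≥ q²·|k̂(q,t)| for every q ∈ 𝒵 with q ≠ 0, and k̂(0,t) ≥ (1−δ)·ψ̂(0), then the function t ↦ k̂(0,t) is nondecreasing on (0, t₁). -/
open Real MeasureTheory Filter Set

/-- `H(p,q₁,q₂) = 1/p - (p-1) q₁ q₂ - q₁²` (as a complex number). -/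
noncomputable def Hcoef (p : ℕ) (q₁ q₂ : ℤ) : ℂ :=
  1 / (p : ℂ) - ((p : ℂ) - 1) * (q₁ : ℂ) * (q₂ : ℂ) - (q₁ : ℂ)^2

/-- The tuples `(q₁,…,q_{p+1})` (with `q_{p+2} := n - q₁ - ⋯ - q_{p+1}` determined) such that
the full `(p+2)`-tuple lies in `𝓐_n ∩ 𝒵^{p+2}`, i.e. all entries belong to `𝒵` and at least two
entries of the full tuple are nonzero. -/
def fullTuple (p : ℕ) (n : ℤ) (v : Fin (p + 1) → ℤ) : Fin (p + 1 + 1) → ℤ :=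
  Fin.snoc v (n - ∑ i, v i)

def goodTuples (p : ℕ) (Z : Finset ℤ) (n : ℤ) : Finset (Fin (p + 1) → ℤ) :=
  (Fintype.piFinset fun _ : Fin (p + 1) => Z).filter fun v =>
    (n - ∑ i, v i) ∈ Z ∧
    ∃ i j : Fin (p + 1 + 1), i ≠ j ∧ fullTuple p n v i ≠ 0 ∧ fullTuple p n v j ≠ 0

/-- The nonlinear term `Σ_{q ∈ 𝓐_n ∩ 𝒵^{p+2}} H(p,q₁,q₂) k̂(q₁,t) ⋯ k̂(q_{p+2},t)`. -/
noncomputable def gSum (p : ℕ) (Z : Finset ℤ) (kh : ℤ → ℝ → ℂ) (n : ℤ) (t : ℝ) : ℂ :=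
  ∑ v ∈ goodTuples p Z n,
    Hcoef p (v 0) (v 1) * (∏ i, kh (v i) t) * kh (n - ∑ i, v i) t

/-- `k̂ : 𝒵 × [0,τ*) → ℂ` is a solution of the Galerkin system
`d/dt k̂(0,t) = (1/p) k̂(0,t)^{p+2} + Σ_{q ∈ 𝓐₀ ∩ 𝒵^{p+2}} H(p,q₁,q₂) k̂(q₁,t)⋯k̂(q_{p+2},t)`,
`d/dt k̂(n,t) = ((p+2)/p - n²) k̂(0,t)^{p+1} k̂(n,t) + Σ_{q ∈ 𝓐_n ∩ 𝒵^{p+2}} H(p,q₁,q₂) k̂(q₁,t)⋯k̂(q_{p+2},t)`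
for `n ∈ 𝒵`, `n ≠ 0`, with initial data `k̂(n,0) = ψ̂(n)` and the reality symmetry
`k̂(-n,t) = conj k̂(n,t)`.  Here `τ* ∈ (0,∞]` is modelled as an extended real number. -/
def IsGalerkin (p : ℕ) (Z : Finset ℤ) (tstar : EReal)
    (kh : ℤ → ℝ → ℂ) (ψh : ℤ → ℂ) : Prop :=
  (∀ t : ℝ, 0 ≤ t → (t : EReal) < tstar →
    HasDerivAt (kh 0) ((1 / (p : ℂ)) * (kh 0 t)^(p + 2) + gSum p Z kh 0 t) t) ∧
  (∀ n ∈ Z, n ≠ 0 → ∀ t : ℝ, 0 ≤ t → (t : EReal) < tstar →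
    HasDerivAt (kh n)
      ((((p : ℂ) + 2) / (p : ℂ) - (n : ℂ)^2) * (kh 0 t)^(p + 1) * kh n t
        + gSum p Z kh n t) t) ∧
  (∀ n ∈ Z, kh n 0 = ψh n) ∧
  (∀ n ∈ Z, ∀ t : ℝ, 0 ≤ t → (t : EReal) < tstar →
    kh (-n) t = (starRingEnd ℂ) (kh n t))

/-- The trigonometric polynomial `k(θ,t) = Σ_{n ∈ 𝒵} k̂(n,t) e^{inθ}`. -/
noncomputable def kpoly (Z : Finset ℤ) (kh : ℤ → ℝ → ℂ) (t θ : ℝ) : ℂ :=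
  ∑ n ∈ Z, kh n t * Complex.exp (Complex.I * (n : ℂ) * (θ : ℂ))

/-- The seminorm `‖ψ‖₂ = max{sup_{n ∈ 𝒵} n²|Re ψ̂(n)|, sup_{n ∈ 𝒵} n²|Im ψ̂(n)|}`. -/
noncomputable def snZ (Z : Finset ℤ) (ψh : ℤ → ℂ) : ℝ :=
  max (⨆ n : Z, ((n : ℤ) : ℝ)^2 * |(ψh n).re|)
      (⨆ n : Z, ((n : ℤ) : ℝ)^2 * |(ψh n).im|)

theorem sum_fullTuple (p : ℕ) (n : ℤ) (v : Fin (p + 1) → ℤ) : ∑ j, fullTuple p n v j = n := by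
  rw [Fin.sum_univ_castSucc]
  simp [fullTuple]

/-- A full tuple is determined by all of its entries but one, because its sum is prescribed. -/
theorem removeNth_fullTuple_injective (p : ℕ) (n : ℤ) (i : Fin (p + 1 + 1)) :
    Function.Injective fun v : Fin (p + 1) → ℤ => i.removeNth (fullTuple p n v) := by
  intro v v' h
  have hrem : ∀ j, fullTuple p n v (i.succAbove j) = fullTuple p n v' (i.succAbove j) :=
    fun j => congrFun h j
  have hi : fullTuple p n v i = fullTuple p n v' i := by
    have hv := sum_fullTuple p n v
    have hv' := sum_fullTuple p n v'
    rw [Fin.sum_univ_succAbove _ i] at hv hv'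
    rw [Finset.sum_congr rfl fun j _ => hrem j] at hv
    linarith
  have hfull : fullTuple p n v = fullTuple p n v' := by
    funext j
    induction j using i.succAboveCases with
    | x => exact hi
    | p j => exact hrem j
  funext j
  simpa [fullTuple] using congrFun hfull j.castSucc

theorem fullTuple_mem {p : ℕ} {Z : Finset ℤ} {n : ℤ} {v : Fin (p + 1) → ℤ}
    (hv : v ∈ goodTuples p Z n) (j : Fin (p + 1 + 1)) : fullTuple p n v j ∈ Z := by
  simp only [goodTuples, Finset.mem_filter, Fintype.mem_piFinset] at hv
  induction j using Fin.lastCases with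
  | last => simpa [fullTuple] using hv.2.1
  | cast j => simpa [fullTuple] using hv.1 j

/-- If `q² a(q) ≤ M` on `Z`, a factor `q_i²` costs only `M`, since the entry `q_i` is determined by
the remaining ones. -/
theorem sum_goodTuples_sq_mul_prod_le (p : ℕ) (Z : Finset ℤ) (n : ℤ) (a : ℤ → ℝ)
    (ha : ∀ q, 0 ≤ a q) {M : ℝ} (hM : 0 ≤ M) (haM : ∀ q ∈ Z, (q : ℝ) ^ 2 * a q ≤ M)
    (i : Fin (p + 1 + 1)) :
    ∑ v ∈ goodTuples p Z n, (fullTuple p n v i : ℝ) ^ 2 * ∏ j, a (fullTuple p n v j) ≤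
      M * (∑ q ∈ Z, a q) ^ (p + 1) := by
  calc ∑ v ∈ goodTuples p Z n, (fullTuple p n v i : ℝ) ^ 2 * ∏ j, a (fullTuple p n v j)
      ≤ ∑ v ∈ goodTuples p Z n, M * ∏ j, a (i.removeNth (fullTuple p n v) j) := by
        refine Finset.sum_le_sum fun v hv => ?_
        rw [Fin.prod_univ_succAbove _ i, ← mul_assoc]
        exact mul_le_mul_of_nonneg_right (haM _ (fullTuple_mem hv i))
          (Finset.prod_nonneg fun _ _ => ha _)
    _ = M * ∑ w ∈ (goodTuples p Z n).image fun v => i.removeNth (fullTuple p n v),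
          ∏ j, a (w j) := by
        rw [Finset.sum_image (removeNth_fullTuple_injective p n i).injOn, Finset.mul_sum]
    _ ≤ M * ∑ w ∈ Fintype.piFinset fun _ : Fin (p + 1) => Z, ∏ j, a (w j) := by
        refine mul_le_mul_of_nonneg_left (Finset.sum_le_sum_of_subset_of_nonneg ?_
          fun _ _ _ => Finset.prod_nonneg fun _ _ => ha _) hM
        intro w hw
        obtain ⟨v, hv, rfl⟩ := Finset.mem_image.1 hw
        exact Fintype.mem_piFinset.2 fun j => fullTuple_mem hv _
    _ = M * (∑ q ∈ Z, a q) ^ (p + 1) := by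
        rw [← Finset.prod_univ_sum]
        simp

theorem norm_Hcoef_le (p : ℕ) (hp : 1 ≤ p) (q₁ q₂ : ℤ) :
    ‖Hcoef p q₁ q₂‖ ≤ 1 + p * ((q₁ : ℝ) ^ 2 + (q₂ : ℝ) ^ 2) := by
  have hp' : (1 : ℝ) ≤ p := by exact_mod_cast hp
  have hcast : Hcoef p q₁ q₂ =
      ((1 / (p : ℝ) - ((p : ℝ) - 1) * q₁ * q₂ - (q₁ : ℝ) ^ 2 : ℝ) : ℂ) := by
    simp [Hcoef]
  have hinv : 1 / (p : ℝ) ≤ 1 := by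
    rw [div_le_one (by positivity)]
    exact hp'
  have hinv0 : 0 ≤ 1 / (p : ℝ) := by positivity
  have hp0 : 0 ≤ (p : ℝ) - 1 := by linarith
  rw [hcast, Complex.norm_real, Real.norm_eq_abs, abs_le]
  constructor
  · nlinarith [mul_nonneg hp0 (sq_nonneg ((q₁ : ℝ) - q₂)), sq_nonneg (q₁ : ℝ), sq_nonneg (q₂ : ℝ),
      mul_nonneg hp0 (sq_nonneg (q₁ : ℝ)), mul_nonneg hp0 (sq_nonneg (q₂ : ℝ))]
  · nlinarith [mul_nonneg hp0 (sq_nonneg ((q₁ : ℝ) + q₂)), sq_nonneg (q₁ : ℝ), sq_nonneg (q₂ : ℝ),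
      mul_nonneg hp0 (sq_nonneg (q₁ : ℝ)), mul_nonneg hp0 (sq_nonneg (q₂ : ℝ))]

theorem norm_Hcoef_le_sum_sq (p : ℕ) (hp : 1 ≤ p) {Z : Finset ℤ} {n : ℤ} {v : Fin (p + 1) → ℤ}
    (hv : v ∈ goodTuples p Z n) :
    ‖Hcoef p (v 0) (v 1)‖ ≤ (p + 1) * ∑ j, (fullTuple p n v j : ℝ) ^ 2 := by
  have hone : (1 : ℝ) ≤ ∑ j, (fullTuple p n v j : ℝ) ^ 2 := by
    obtain ⟨i, -, -, hi, -⟩ := (Finset.mem_filter.1 hv).2.2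
    have h1 : (1 : ℝ) ≤ (fullTuple p n v i : ℝ) ^ 2 := by
      exact_mod_cast Order.one_le_iff_pos.2 (sq_pos_of_ne_zero hi)
    exact h1.trans (Finset.single_le_sum (f := fun j => (fullTuple p n v j : ℝ) ^ 2)
      (fun _ _ => sq_nonneg _) (Finset.mem_univ i))
  have h01 : (0 : Fin (p + 1)) ≠ 1 := by
    obtain ⟨m, rfl⟩ := Nat.exists_eq_add_of_le' hp
    simp
  have htwo : (v 0 : ℝ) ^ 2 + (v 1 : ℝ) ^ 2 ≤ ∑ j, (fullTuple p n v j : ℝ) ^ 2 := by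
    rw [Fin.sum_univ_castSucc]
    have hpair := Finset.sum_le_sum_of_subset_of_nonneg (f := fun j => (v j : ℝ) ^ 2)
      (Finset.subset_univ {0, 1}) fun _ _ _ => sq_nonneg _
    rw [Finset.sum_pair h01] at hpair
    simp only [fullTuple, Fin.snoc_castSucc]
    exact hpair.trans (le_add_of_nonneg_right (sq_nonneg _))
  have := norm_Hcoef_le p hp (v 0) (v 1)
  have := mul_le_mul_of_nonneg_left htwo (Nat.cast_nonneg (α := ℝ) p)
  linarith

theorem norm_gSum_le (p : ℕ) (hp : 1 ≤ p) (Z : Finset ℤ) (kh : ℤ → ℝ → ℂ) (n : ℤ) (t : ℝ)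
    {M : ℝ} (hM : 0 ≤ M) (hkM : ∀ q ∈ Z, (q : ℝ) ^ 2 * ‖kh q t‖ ≤ M) :
    ‖gSum p Z kh n t‖ ≤ (p + 1) * (p + 2) * (M * (∑ q ∈ Z, ‖kh q t‖) ^ (p + 1)) := by
  have hterm : ∀ v ∈ goodTuples p Z n,
      ‖Hcoef p (v 0) (v 1) * (∏ i, kh (v i) t) * kh (n - ∑ i, v i) t‖ ≤
        (p + 1) * ∑ i, (fullTuple p n v i : ℝ) ^ 2 * ∏ j, ‖kh (fullTuple p n v j) t‖ := by
    intro v hv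
    have hprod : ∏ j, ‖kh (fullTuple p n v j) t‖ =
        ‖∏ i, kh (v i) t‖ * ‖kh (n - ∑ i, v i) t‖ := by
      rw [Fin.prod_univ_castSucc]
      simp [fullTuple]
    rw [norm_mul, norm_mul, mul_assoc, ← hprod, ← Finset.sum_mul, ← mul_assoc]
    exact mul_le_mul_of_nonneg_right (norm_Hcoef_le_sum_sq p hp hv)
      (Finset.prod_nonneg fun _ _ => norm_nonneg _)
  calc ‖gSum p Z kh n t‖
      ≤ ∑ v ∈ goodTuples p Z n,
          (p + 1) * ∑ i, (fullTuple p n v i : ℝ) ^ 2 * ∏ j, ‖kh (fullTuple p n v j) t‖ :=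
        norm_sum_le_of_le _ hterm
    _ = (p + 1) * ∑ i, ∑ v ∈ goodTuples p Z n,
          (fullTuple p n v i : ℝ) ^ 2 * ∏ j, ‖kh (fullTuple p n v j) t‖ := by
        rw [← Finset.mul_sum, Finset.sum_comm]
    _ ≤ (p + 1) * ∑ _i : Fin (p + 1 + 1), M * (∑ q ∈ Z, ‖kh q t‖) ^ (p + 1) := by
        gcongr with i
        exact sum_goodTuples_sq_mul_prod_le p Z n (fun q => ‖kh q t‖) (fun _ => norm_nonneg _)
          hM hkM i
    _ = (p + 1) * (p + 2) * (M * (∑ q ∈ Z, ‖kh q t‖) ^ (p + 1)) := by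
        simp
        ring

theorem sum_le_add_mul_tsum_inv_sq (Z : Finset ℤ) (hZ : (0 : ℤ) ∈ Z) (a : ℤ → ℝ) {M : ℝ}
    (hM : 0 ≤ M) (haM : ∀ q ∈ Z, (q : ℝ) ^ 2 * a q ≤ M) :
    ∑ q ∈ Z, a q ≤ a 0 + M * ∑' q : ℤ, 1 / (q : ℝ) ^ 2 := by
  rw [← Finset.add_sum_erase _ _ hZ]
  gcongr
  calc ∑ q ∈ Z.erase 0, a q ≤ ∑ q ∈ Z.erase 0, M * (1 / (q : ℝ) ^ 2) := by
        refine Finset.sum_le_sum fun q hq => ?_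
        obtain ⟨hq0, hqZ⟩ := Finset.mem_erase.1 hq
        have hq2 : 0 < (q : ℝ) ^ 2 := by positivity
        rw [mul_one_div, le_div_iff₀ hq2, mul_comm]
        exact haM q hqZ
    _ ≤ M * ∑' q : ℤ, 1 / (q : ℝ) ^ 2 := by
        rw [← Finset.mul_sum]
        exact mul_le_mul_of_nonneg_left ((Real.summable_one_div_int_pow.2 one_lt_two).sum_le_tsum _
          fun _ _ => by positivity) hM

/-- Right-hand side of the zero-mode equation: the leading term dominates when `δ` is small. -/
theorem re_zeroMode_rhs_nonneg (p : ℕ) (hp : 1 ≤ p) (Z : Finset ℤ) (hZ : (0 : ℤ) ∈ Z)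
    (kh : ℤ → ℝ → ℂ) (t : ℝ) {δ A x : ℝ} (hδ : 0 ≤ δ) (hδ4 : δ ≤ 1 / 4) (hA : 0 ≤ A)
    (hδp : 4 * p * (p + 1) * (p + 2) * (1 + ∑' q : ℤ, 1 / (q : ℝ) ^ 2) ^ (p + 1) * δ ≤ 1)
    (hx : kh 0 t = x) (hAx : (1 - δ) * A ≤ x)
    (hk : ∀ q ∈ Z, (q : ℝ) ^ 2 * ‖kh q t‖ ≤ 2 * δ * A) :
    0 ≤ ((1 / (p : ℂ)) * (kh 0 t) ^ (p + 2) + gSum p Z kh 0 t).re := by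
  set B := ∑' q : ℤ, 1 / (q : ℝ) ^ 2 with hB
  have hB0 : 0 ≤ B := tsum_nonneg fun _ => by positivity
  have hp0 : (0 : ℝ) < p := by exact_mod_cast hp
  have hAx2 : A ≤ 2 * x := by nlinarith
  have hx0 : 0 ≤ x := by linarith
  have hM : 0 ≤ 2 * δ * A := by positivity
  have hMx : 2 * δ * A ≤ 4 * δ * x := by nlinarith
  have hsum : ∑ q ∈ Z, ‖kh q t‖ ≤ (1 + B) * x := by
    have h := sum_le_add_mul_tsum_inv_sq Z hZ (fun q => ‖kh q t‖) hM hk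
    simp only [hx, Complex.norm_real, Real.norm_eq_abs, abs_of_nonneg hx0, ← hB] at h
    have : 2 * δ * A * B ≤ x * B := mul_le_mul_of_nonneg_right (by nlinarith) hB0
    linarith
  have hgSum : ‖gSum p Z kh 0 t‖ ≤ 1 / p * x ^ (p + 2) := by
    calc ‖gSum p Z kh 0 t‖
        ≤ (p + 1) * (p + 2) * (2 * δ * A * (∑ q ∈ Z, ‖kh q t‖) ^ (p + 1)) :=
          norm_gSum_le p hp Z kh 0 t hM hk
      _ ≤ (p + 1) * (p + 2) * (4 * δ * x * ((1 + B) * x) ^ (p + 1)) := by gcongr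
      _ = 4 * p * (p + 1) * (p + 2) * (1 + B) ^ (p + 1) * δ * (1 / p * x ^ (p + 2)) := by
          rw [mul_pow]
          field_simp
          ring
      _ ≤ 1 / p * x ^ (p + 2) := mul_le_of_le_one_left (by positivity) hδp
  have hlead : ((1 / (p : ℂ)) * (kh 0 t) ^ (p + 2)).re = 1 / p * x ^ (p + 2) := by
    rw [hx]
    have : (1 / (p : ℂ)) * (x : ℂ) ^ (p + 2) = ((1 / (p : ℝ) * x ^ (p + 2) : ℝ) : ℂ) := by
      push_cast
      rfl
    rw [this, Complex.ofReal_re]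
  rw [Complex.add_re, hlead]
  have := (abs_le.1 (Complex.abs_re_le_norm (gSum p Z kh 0 t))).1
  linarith

/-- There is `δ ∈ (0,1/4)` depending only on `p` such that: if on `(0,t₁)` one
has `2δ ψ̂(0) ≥ q² |k̂(q,t)|` for all nonzero `q ∈ 𝒵` and `k̂(0,t) ≥ (1-δ) ψ̂(0)`, then
`t ↦ k̂(0,t)` is nondecreasing on `(0,t₁)`. -/
theorem statement2 (p : ℕ) (hp : 1 ≤ p) :
    ∃ δ : ℝ, δ ∈ Set.Ioo (0:ℝ) (1/4) ∧
      ∀ (Z : Finset ℤ), (0:ℤ) ∈ Z → (∀ n ∈ Z, -n ∈ Z) →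
      ∀ (tstar : EReal), 0 < tstar →
      ∀ (kh : ℤ → ℝ → ℂ) (ψh : ℤ → ℂ), IsGalerkin p Z tstar kh ψh →
      0 < (ψh 0).re →
      ∀ t₁ : ℝ, 0 < t₁ → (t₁ : EReal) < tstar →
      (∀ t : ℝ, 0 < t → t < t₁ →
        (∀ q ∈ Z, q ≠ 0 → (q : ℝ)^2 * ‖kh q t‖ ≤ 2 * δ * (ψh 0).re) ∧
        (1 - δ) * (ψh 0).re ≤ (kh 0 t).re) →
      MonotoneOn (fun t => (kh 0 t).re) (Set.Ioo 0 t₁) := by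
  set B := ∑' q : ℤ, 1 / (q : ℝ) ^ 2
  have hB0 : 0 ≤ B := tsum_nonneg fun _ => by positivity
  have hp1 : (1 : ℝ) ≤ p := by exact_mod_cast hp
  set K : ℝ := 4 * p * (p + 1) * (p + 2) * (1 + B) ^ (p + 1)
  have hK4 : 4 < K := by
    have h1 : 1 ≤ (1 + B) ^ (p + 1) := one_le_pow₀ (by linarith)
    have h2 : (4 : ℝ) < 4 * p * (p + 1) * (p + 2) := by
      nlinarith [pow_pos (zero_lt_one.trans_le hp1) 2]
    nlinarith
  have hδ0 : 0 < 1 / K := by positivity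
  have hδ4 : 1 / K < 1 / 4 := one_div_lt_one_div_of_lt (by norm_num) hK4
  refine ⟨1 / K, ⟨hδ0, hδ4⟩, ?_⟩
  intro Z hZ _ tstar _ kh ψh hG hA t₁ _ ht₁ hbd
  have hlt : ∀ t : ℝ, t < t₁ → (t : EReal) < tstar := fun t ht =>
    (EReal.coe_lt_coe_iff.2 ht).trans ht₁
  have hderiv : ∀ t ∈ Ioo 0 t₁, HasDerivAt (fun t => (kh 0 t).re)
      ((1 / (p : ℂ)) * (kh 0 t) ^ (p + 2) + gSum p Z kh 0 t).re t := fun t ht =>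
    Complex.reCLM.hasFDerivAt.comp_hasDerivAt t (hG.1 t ht.1.le (hlt t ht.2))
  refine monotoneOn_of_deriv_nonneg (convex_Ioo 0 t₁)
    (fun t ht => (hderiv t ht).continuousAt.continuousWithinAt) ?_ ?_
  · rw [interior_Ioo]
    exact fun t ht => (hderiv t ht).differentiableAt.differentiableWithinAt
  · rw [interior_Ioo]
    intro t ht
    rw [(hderiv t ht).deriv]
    obtain ⟨hk, hk0⟩ := hbd t ht.1 ht.2
    have hreal : kh 0 t = ((kh 0 t).re : ℂ) := by
      have h := hG.2.2.2 0 hZ t ht.1.le (hlt t ht.2)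
      rw [neg_zero] at h
      exact (Complex.conj_eq_iff_re.1 h.symm).symm
    refine re_zeroMode_rhs_nonneg p hp Z hZ kh t hδ0.le hδ4.le hA.le
      (mul_one_div_cancel (by positivity)).le hreal hk0 fun q hq => ?_
    rcases eq_or_ne q 0 with rfl | hq0
    · simpa using mul_nonneg (mul_nonneg zero_le_two hδ0.le) hA.le
    · exact hk q hq hq0
end

section
/- There exists δ' ∈ (0, 1/4), depending only on p (independent of 𝒵 and of the solution), such that for every δ ∈ (0, δ'] the following holds. Suppose δ·ψ̂(0) ≥ |ψ̂(±1)|, suppose the trigonometric polynomial k(θ,t) = Σ_{n∈𝒵} k̂(n,t)·e^{inθ} is strictly positive and satisfies ∫₀^{2π} e^{iθ}/k(θ,t) dθ = 0 for every t ∈ [0, t₁], and suppose n²·|k̂(n,t)| ≤ δ·k̂(0,t) for every n ∈ 𝒵 with |n| ≥ 2 and every t ∈ [0, t₁]. Then also |k̂(q,t)| ≤ δ·k̂(0,t) for q = ±1 and every t ∈ [0, t₁]. -/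
open Real MeasureTheory Filter Set

/-- `∑ 1/n²` over any finite set of integers with `|n| ≥ 2` is at most `2`. -/
theorem sum_inv_sq_int_le_two (T : Finset ℤ) (hT : ∀ n ∈ T, 2 ≤ |n|) :
    ∑ n ∈ T, ((n : ℝ) ^ 2)⁻¹ ≤ 2 := by
  classical
  set N : ℕ := T.sup Int.natAbs + 1
  set S : Finset ℕ := Finset.Ioo 1 N
  have hS : ∑ i ∈ S, ((i : ℝ) ^ 2)⁻¹ ≤ 1 := by
    have h := sum_Ioo_inv_sq_le (α := ℝ) 1 N
    norm_num at h ⊢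
    exact h
  have hsub : T ⊆ S.image (fun i : ℕ => (i : ℤ)) ∪ S.image (fun i : ℕ => -(i : ℤ)) := by
    intro n hn
    have h2 := hT n hn
    have hle : n.natAbs ≤ T.sup Int.natAbs := Finset.le_sup (f := Int.natAbs) hn
    have hmem : n.natAbs ∈ S := by
      simp only [S, N, Finset.mem_Ioo]
      rw [Int.abs_eq_natAbs] at h2
      omega
    rcases Int.natAbs_eq n with h | h
    · exact Finset.mem_union_left _ (Finset.mem_image.2 ⟨_, hmem, h.symm⟩)
    · exact Finset.mem_union_right _ (Finset.mem_image.2 ⟨_, hmem, h.symm⟩)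
  have hunion : ∑ n ∈ S.image (fun i : ℕ => (i : ℤ)) ∪ S.image (fun i : ℕ => -(i : ℤ)),
      ((n : ℝ) ^ 2)⁻¹ ≤ ∑ n ∈ S.image (fun i : ℕ => (i : ℤ)), ((n : ℝ) ^ 2)⁻¹
        + ∑ n ∈ S.image (fun i : ℕ => -(i : ℤ)), ((n : ℝ) ^ 2)⁻¹ := by
    rw [← Finset.sum_union_inter]
    exact le_add_of_nonneg_right (Finset.sum_nonneg fun _ _ => by positivity)
  calc ∑ n ∈ T, ((n : ℝ) ^ 2)⁻¹
      ≤ _ := Finset.sum_le_sum_of_subset_of_nonneg hsub fun _ _ _ => by positivity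
    _ ≤ _ := hunion
    _ = ∑ i ∈ S, ((i : ℝ) ^ 2)⁻¹ + ∑ i ∈ S, ((i : ℝ) ^ 2)⁻¹ := by
        rw [Finset.sum_image (by intro a _ b _ h; simpa using h),
          Finset.sum_image (by intro a _ b _ h; simpa using h)]
        simp
    _ ≤ 2 := by linarith

theorem continuous_kpoly (Z : Finset ℤ) (kh : ℤ → ℝ → ℂ) (t : ℝ) :
    Continuous (kpoly Z kh t) := by
  unfold kpoly
  fun_prop

theorem integral_exp_int_mul (m : ℤ) :
    ∫ θ in (0 : ℝ)..(2 * π), Complex.exp (Complex.I * (m : ℂ) * (θ : ℂ))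
      = if m = 0 then (2 * π : ℂ) else 0 := by
  split_ifs with h
  · simp [h]
  · rw [integral_exp_mul_complex (by simp [h])]
    have : Complex.I * (m : ℂ) * ((2 * π : ℝ) : ℂ) = m * (2 * π * Complex.I) := by
      push_cast; ring
    rw [this, Complex.exp_int_mul_two_pi_mul_I]
    simp

/-- Fourier coefficients of the trigonometric polynomial `kpoly`. -/
theorem integral_exp_mul_kpoly {Z : Finset ℤ} (kh : ℤ → ℝ → ℂ) (t : ℝ) {m : ℤ} (hm : -m ∈ Z) :
    ∫ θ in (0 : ℝ)..(2 * π), Complex.exp (Complex.I * (m : ℂ) * (θ : ℂ)) * kpoly Z kh t θ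
      = 2 * π * kh (-m) t := by
  have h : ∀ θ : ℝ, Complex.exp (Complex.I * (m : ℂ) * (θ : ℂ)) * kpoly Z kh t θ
      = ∑ n ∈ Z, kh n t * Complex.exp (Complex.I * ((m + n : ℤ) : ℂ) * (θ : ℂ)) := by
    intro θ
    rw [kpoly, Finset.mul_sum]
    refine Finset.sum_congr rfl fun n _ => ?_
    rw [mul_left_comm, ← Complex.exp_add]
    push_cast
    ring_nf
  simp_rw [h]
  rw [intervalIntegral.integral_finsetSum
    fun n _ => (Continuous.intervalIntegrable (by fun_prop) _ _)]
  simp_rw [intervalIntegral.integral_const_mul, integral_exp_int_mul]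
  rw [Finset.sum_eq_single_of_mem (-m) hm]
  · simp; ring
  · intro n _ hn
    rw [if_neg (by omega), mul_zero]

theorem re_coeff_zero_pos {Z : Finset ℤ} (h0 : (0 : ℤ) ∈ Z) (kh : ℤ → ℝ → ℂ) (t : ℝ)
    (hpos : ∀ θ : ℝ, 0 < (kpoly Z kh t θ).re) : 0 < (kh 0 t).re := by
  have hc := continuous_kpoly Z kh t
  have h1 : ∫ θ in (0 : ℝ)..(2 * π), kpoly Z kh t θ = 2 * π * kh 0 t := by
    simpa using integral_exp_mul_kpoly kh t (m := 0) (by simpa using h0)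
  have h2 : 0 < ∫ θ in (0 : ℝ)..(2 * π), (kpoly Z kh t θ).re :=
    intervalIntegral.intervalIntegral_pos_of_pos
      ((Complex.continuous_re.comp hc).intervalIntegrable _ _) hpos (by positivity)
  have h3 : ∫ θ in (0 : ℝ)..(2 * π), (kpoly Z kh t θ).re = 2 * π * (kh 0 t).re := by
    have := Complex.reCLM.intervalIntegral_comp_comm (hc.intervalIntegrable 0 (2 * π)) (μ := volume)
    simp only [Complex.reCLM_apply] at this
    rw [this, h1]
    simp
  rw [h3] at h2
  exact pos_of_mul_pos_right h2 (by positivity)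

/-- The oscillating part of `k` is controlled by its first modes and the decay of the others. -/
theorem norm_kpoly_sub_le {Z : Finset ℤ} (h0 : (0 : ℤ) ∈ Z) (kh : ℤ → ℝ → ℂ) (t : ℝ) {b M : ℝ}
    (hM : 0 ≤ M) (h1 : ‖kh 1 t‖ ≤ b) (h1' : ‖kh (-1) t‖ ≤ b)
    (h2 : ∀ n ∈ Z, 2 ≤ |n| → (n : ℝ) ^ 2 * ‖kh n t‖ ≤ M) (θ : ℝ) :
    ‖kpoly Z kh t θ - kh 0 t‖ ≤ 2 * b + 2 * M := by
  classical
  set T := Z.filter fun n => 2 ≤ |n|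
  have hsplit : kpoly Z kh t θ - kh 0 t
      = ∑ n ∈ Z.erase 0, kh n t * Complex.exp (Complex.I * (n : ℂ) * (θ : ℂ)) := by
    rw [kpoly, ← Finset.add_sum_erase Z _ h0]
    simp
  have hsub : Z.erase 0 ⊆ {1, -1} ∪ T := by
    intro n hn
    obtain ⟨hn0, hnZ⟩ := Finset.mem_erase.1 hn
    simp only [T, Finset.mem_union, Finset.mem_insert, Finset.mem_singleton, Finset.mem_filter]
    by_cases h : 2 ≤ |n|
    · exact Or.inr ⟨hnZ, h⟩
    · left
      rw [Int.abs_eq_natAbs] at h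
      omega
  have hdisj : Disjoint ({1, -1} : Finset ℤ) T := by
    simp [T]
  have hT : ∑ n ∈ T, ‖kh n t‖ ≤ 2 * M := by
    calc ∑ n ∈ T, ‖kh n t‖ ≤ ∑ n ∈ T, M * ((n : ℝ) ^ 2)⁻¹ := by
          refine Finset.sum_le_sum fun n hn => ?_
          obtain ⟨hnZ, hn2⟩ := Finset.mem_filter.1 hn
          have hn0 : (n : ℝ) ≠ 0 := by
            have : n ≠ 0 := by rintro rfl; simp at hn2
            exact_mod_cast this
          rw [← div_eq_mul_inv, le_div_iff₀ (by positivity), mul_comm]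
          exact h2 n hnZ hn2
      _ = M * ∑ n ∈ T, ((n : ℝ) ^ 2)⁻¹ := by rw [Finset.mul_sum]
      _ ≤ M * 2 := mul_le_mul_of_nonneg_left
          (sum_inv_sq_int_le_two T fun n hn => (Finset.mem_filter.1 hn).2) hM
      _ = 2 * M := mul_comm _ _
  calc ‖kpoly Z kh t θ - kh 0 t‖
      ≤ ∑ n ∈ Z.erase 0, ‖kh n t‖ := by
        rw [hsplit]
        refine (norm_sum_le _ _).trans_eq (Finset.sum_congr rfl fun n _ => ?_)
        have : Complex.I * (n : ℂ) * (θ : ℂ) = ((n * θ : ℝ) : ℂ) * Complex.I := by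
          push_cast; ring
        rw [norm_mul, this, Complex.norm_exp_ofReal_mul_I, mul_one]
    _ ≤ ∑ n ∈ {1, -1} ∪ T, ‖kh n t‖ :=
        Finset.sum_le_sum_of_subset_of_nonneg hsub fun _ _ _ => norm_nonneg _
    _ = ‖kh 1 t‖ + ‖kh (-1) t‖ + ∑ n ∈ T, ‖kh n t‖ := by
        rw [Finset.sum_union hdisj, Finset.sum_pair (by norm_num)]
    _ ≤ 2 * b + 2 * M := by linarith

/-- If `∫ e^{iθ}/k = 0` and `k` stays `M`-close to its mean, its first Fourier coefficient is
quadratically small in `M`. -/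
theorem norm_coeff_neg_one_le {Z : Finset ℤ} (h1 : (-1 : ℤ) ∈ Z) (kh : ℤ → ℝ → ℂ) (t : ℝ)
    {M : ℝ} (hM : M < ‖kh 0 t‖) (hW : ∀ θ : ℝ, ‖kpoly Z kh t θ - kh 0 t‖ ≤ M)
    (hint : ∫ θ in (0 : ℝ)..(2 * π), Complex.exp (Complex.I * (θ : ℂ)) / kpoly Z kh t θ = 0) :
    ‖kh (-1) t‖ ≤ M ^ 2 / (‖kh 0 t‖ - M) := by
  set a := kh 0 t
  have hc := continuous_kpoly Z kh t
  have hlow : ∀ θ, ‖a‖ - M ≤ ‖kpoly Z kh t θ‖ := by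
    intro θ
    have := norm_sub_norm_le a (kpoly Z kh t θ)
    rw [norm_sub_rev] at this
    linarith [hW θ]
  have hne : ∀ θ, kpoly Z kh t θ ≠ 0 := fun θ =>
    norm_pos_iff.1 (lt_of_lt_of_le (sub_pos.2 hM) (hlow θ))
  have hid : ∀ θ : ℝ,
      Complex.exp (Complex.I * (θ : ℂ)) * (kpoly Z kh t θ - a) ^ 2 / kpoly Z kh t θ
        = Complex.exp (Complex.I * (θ : ℂ)) * kpoly Z kh t θ
          - 2 * a * Complex.exp (Complex.I * (θ : ℂ))
          + a ^ 2 * (Complex.exp (Complex.I * (θ : ℂ)) / kpoly Z kh t θ) := by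
    intro θ
    field_simp [hne θ]
    ring
  have hcoef : ∫ θ in (0 : ℝ)..(2 * π), Complex.exp (Complex.I * (θ : ℂ)) * kpoly Z kh t θ
      = 2 * π * kh (-1) t := by
    simpa using integral_exp_mul_kpoly kh t (m := 1) h1
  have hexp : ∫ θ in (0 : ℝ)..(2 * π), Complex.exp (Complex.I * (θ : ℂ)) = 0 := by
    simpa using integral_exp_int_mul 1
  have hce : Continuous fun θ : ℝ => Complex.exp (Complex.I * (θ : ℂ)) := by fun_prop
  have hcd : Continuous fun θ : ℝ => Complex.exp (Complex.I * (θ : ℂ)) / kpoly Z kh t θ :=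
    hce.div hc hne
  have hval : ∫ θ in (0 : ℝ)..(2 * π),
      Complex.exp (Complex.I * (θ : ℂ)) * (kpoly Z kh t θ - a) ^ 2 / kpoly Z kh t θ
        = 2 * π * kh (-1) t := by
    simp_rw [hid]
    rw [intervalIntegral.integral_add
        (Continuous.intervalIntegrable (by fun_prop) _ _)
        (Continuous.intervalIntegrable (by fun_prop) _ _),
      intervalIntegral.integral_sub
        (Continuous.intervalIntegrable (by fun_prop) _ _)
        (Continuous.intervalIntegrable (by fun_prop) _ _),
      intervalIntegral.integral_const_mul, intervalIntegral.integral_const_mul,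
      hcoef, hexp, hint]
    simp
  have hbound := intervalIntegral.norm_integral_le_of_norm_le_const
    (a := (0 : ℝ)) (b := 2 * π) (C := M ^ 2 / (‖a‖ - M))
    (f := fun θ : ℝ =>
      Complex.exp (Complex.I * (θ : ℂ)) * (kpoly Z kh t θ - a) ^ 2 / kpoly Z kh t θ) <| by
      intro θ _
      rw [norm_div, norm_mul, norm_pow, mul_comm Complex.I, Complex.norm_exp_ofReal_mul_I, one_mul]
      have := hW θ
      have := hlow θ
      have := sub_pos.2 hM
      gcongr
  rw [hval, sub_zero, abs_of_pos (by positivity), norm_mul, norm_mul, Complex.norm_real,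
    Real.norm_of_nonneg pi_pos.le, Complex.norm_ofNat, mul_comm] at hbound
  exact le_of_mul_le_mul_right hbound (by positivity)

/-- The gap: no value of `‖k̂(±1)‖ / k̂(0)` lies strictly between `δ` and `1/20`. -/
theorem norm_coeff_one_le_of_lt {Z : Finset ℤ} (h0 : (0 : ℤ) ∈ Z) (h1 : (-1 : ℤ) ∈ Z)
    (kh : ℤ → ℝ → ℂ) (t : ℝ) {δ : ℝ} (hδ : 0 < δ) (hδ' : δ ≤ 1 / 40)
    (hsymm : ‖kh (-1) t‖ = ‖kh 1 t‖) (ha : 0 < (kh 0 t).re)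
    (hint : ∫ θ in (0 : ℝ)..(2 * π), Complex.exp (Complex.I * (θ : ℂ)) / kpoly Z kh t θ = 0)
    (h2 : ∀ n ∈ Z, 2 ≤ |n| → (n : ℝ) ^ 2 * ‖kh n t‖ ≤ δ * (kh 0 t).re)
    (hlt : ‖kh 1 t‖ < 1 / 20 * (kh 0 t).re) : ‖kh 1 t‖ ≤ δ * (kh 0 t).re := by
  by_contra! hcon
  have hna : (kh 0 t).re ≤ ‖kh 0 t‖ := Complex.re_le_norm _
  set a := (kh 0 t).re
  set b := ‖kh 1 t‖
  have hδa : δ * a ≤ 1 / 40 * a := by gcongr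
  have hδa0 : 0 < δ * a := by positivity
  have hb0 : 0 < b := hδa0.trans hcon
  have hW := norm_kpoly_sub_le h0 kh t hδa0.le le_rfl hsymm.le h2
  have hW' : ∀ θ, ‖kpoly Z kh t θ - kh 0 t‖ ≤ 4 * b := fun θ => (hW θ).trans (by linarith)
  have key := norm_coeff_neg_one_le h1 kh t (by linarith) hW' hint
  rw [hsymm, le_div_iff₀ (by linarith)] at key
  nlinarith

/-- There is `δ' ∈ (0,1/4)` depending only on `p` such that for all
`δ ∈ (0,δ']`: if `δ ψ̂(0) ≥ |ψ̂(±1)|`, the trigonometric polynomial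
`k(θ,t) = Σ_{n ∈ 𝒵} k̂(n,t) e^{inθ}` is strictly positive with
`∫₀^{2π} e^{iθ}/k(θ,t) dθ = 0` on `[0,t₁]`, and `n² |k̂(n,t)| ≤ δ k̂(0,t)` for `|n| ≥ 2` on
`[0,t₁]`, then also `|k̂(±1,t)| ≤ δ k̂(0,t)` on `[0,t₁]`. -/
theorem statement4 (p : ℕ) (hp : 1 ≤ p) :
    ∃ δ' : ℝ, δ' ∈ Set.Ioo (0:ℝ) (1/4) ∧
      ∀ δ : ℝ, 0 < δ → δ ≤ δ' →
      ∀ (Z : Finset ℤ), (0:ℤ) ∈ Z → (∀ n ∈ Z, -n ∈ Z) →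
      ∀ (tstar : EReal), 0 < tstar →
      ∀ (kh : ℤ → ℝ → ℂ) (ψh : ℤ → ℂ), IsGalerkin p Z tstar kh ψh →
      0 < (ψh 0).re →
      ∀ t₁ : ℝ, 0 < t₁ → (t₁ : EReal) < tstar →
      (∀ q ∈ Z, (q = 1 ∨ q = -1) → ‖ψh q‖ ≤ δ * (ψh 0).re) →
      (∀ t : ℝ, 0 ≤ t → t ≤ t₁ → ∀ θ : ℝ, 0 < (kpoly Z kh t θ).re) →
      (∀ t : ℝ, 0 ≤ t → t ≤ t₁ →
        (∫ θ in (0:ℝ)..(2 * Real.pi),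
          Complex.exp (Complex.I * (θ : ℂ)) / kpoly Z kh t θ) = 0) →
      (∀ t : ℝ, 0 ≤ t → t ≤ t₁ → ∀ n ∈ Z, 2 ≤ |n| →
        (n : ℝ)^2 * ‖kh n t‖ ≤ δ * (kh 0 t).re) →
      ∀ t : ℝ, 0 ≤ t → t ≤ t₁ → ∀ q ∈ Z, (q = 1 ∨ q = -1) →
        ‖kh q t‖ ≤ δ * (kh 0 t).re := by
  refine ⟨1 / 40, ⟨by norm_num, by norm_num⟩, ?_⟩
  intro δ hδ hδ' Z h0 hZ tstar _ kh ψh hG _ t₁ _ ht₁ hinit hpos hint hdecay t ht htt q hq hq1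
  obtain ⟨hd0, hdn, hψ, hconj⟩ := hG
  have hlt : ∀ s : ℝ, s ≤ t₁ → (s : EReal) < tstar := fun s hs =>
    lt_of_le_of_lt (EReal.coe_le_coe_iff.2 hs) ht₁
  have hmem : (1 : ℤ) ∈ Z := by
    rcases hq1 with rfl | rfl
    · exact hq
    · simpa using hZ _ hq
  have hmem' : (-1 : ℤ) ∈ Z := hZ 1 hmem
  have hsymm : ∀ s : ℝ, 0 ≤ s → s ≤ t₁ → ‖kh (-1) s‖ = ‖kh 1 s‖ := fun s hs hs' => by
    rw [hconj 1 hmem s hs (hlt s hs'), RCLike.norm_conj]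
  have hgap : ∀ s : ℝ, 0 ≤ s → s ≤ t₁ → ‖kh 1 s‖ < 1 / 20 * (kh 0 s).re →
      ‖kh 1 s‖ ≤ δ * (kh 0 s).re := fun s hs hs' =>
    norm_coeff_one_le_of_lt h0 hmem' kh s hδ hδ' (hsymm s hs hs')
      (re_coeff_zero_pos h0 kh s (hpos s hs hs')) (hint s hs hs') (hdecay s hs hs')
  have hone : ‖kh 1 t‖ ≤ δ * (kh 0 t).re := by
    refine hgap t ht htt ?_
    by_contra! hcon
    have hcont : ContinuousOn (fun s => ‖kh 1 s‖ - 3 / 80 * (kh 0 s).re) (Set.Icc 0 t) := by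
      intro s hs
      have hc1 := (hdn 1 hmem one_ne_zero s hs.1 (hlt s (hs.2.trans htt))).continuousAt
      have hc0 := (hd0 s hs.1 (hlt s (hs.2.trans htt))).continuousAt
      exact (hc1.norm.sub (continuousAt_const.mul
        (Complex.continuous_re.continuousAt.comp hc0))).continuousWithinAt
    have ha0 := re_coeff_zero_pos h0 kh 0 (hpos 0 le_rfl (ht.trans htt))
    have hat := re_coeff_zero_pos h0 kh t (hpos t ht htt)
    have hstart : ‖kh 1 0‖ ≤ δ * (kh 0 0).re := by
      rw [hψ 1 hmem, hψ 0 h0]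
      exact hinit 1 hmem (Or.inl rfl)
    obtain ⟨s, hs, hs0⟩ := intermediate_value_Icc ht hcont
      (show (0 : ℝ) ∈ Set.Icc _ _ from ⟨by nlinarith, by linarith⟩)
    have has := re_coeff_zero_pos h0 kh s (hpos s hs.1 (hs.2.trans htt))
    have hs0 : ‖kh 1 s‖ - 3 / 80 * (kh 0 s).re = 0 := hs0
    have := hgap s hs.1 (hs.2.trans htt) (by linarith)
    nlinarith
  rcases hq1 with rfl | rfl
  · exact hone
  · rwa [hsymm t ht htt]
end
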